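/- Let σ > 1 and let (u_ε)_{ε∈(0,1]} be a family of tempered distributions on ℝⁿ whose Fourier transforms satisfy |û_ε(ξ)| ≤ c' ε^{-N} exp(−c ε^{1/σ} ⟨ξ⟩^{1/σ}) for some c, c' > 0, N ∈ ℕ and all ξ ∈ ℝⁿ, ε ∈ (0,1]. Then each u_ε is smooth and there exist C > 0 and M ∈ ℕ such that |∂^α u_ε(x)| ≤ C^{|α|+1}(α!)^σ ε^{-|α|-M} for all multi-indices α, all x ∈ ℝⁿ and all ε ∈ (0,1]. -/

import Mathlib

open MeasureTheory

noncomputable def pd {n : ℕ} {F : Type} [NormedAddCommGroup F] [NormedSpace ℝ F]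
    (i : Fin n) (f : (Fin n → ℝ) → F) : (Fin n → ℝ) → F :=
  fun x => fderiv ℝ f x (Pi.single i 1)

/-- Multi-index partial derivative ∂^α. -/
noncomputable def mderiv {n : ℕ} {F : Type} [NormedAddCommGroup F] [NormedSpace ℝ F]
    (α : Fin n → ℕ) (f : (Fin n → ℝ) → F) : (Fin n → ℝ) → F :=
  (List.finRange n).foldr (fun i g => (pd i)^[α i] g) f

/-- |α| -/
def mdeg {n : ℕ} (α : Fin n → ℕ) : ℕ := ∑ i, α i

/-- α! -/
def mfact {n : ℕ} (α : Fin n → ℕ) : ℕ := ∏ i, Nat.factorial (α i)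

/-- Japanese bracket ⟨ξ⟩. -/
noncomputable def jb {n : ℕ} (ξ : Fin n → ℝ) : ℝ := Real.sqrt (1 + ∑ i, ξ i ^ 2)

/-- Fourier transform. -/
noncomputable def ft {n : ℕ} (u : (Fin n → ℝ) → ℂ) (ξ : Fin n → ℝ) : ℂ :=
  ∫ x, Complex.exp (-Complex.I * ((∑ i, x i * ξ i : ℝ) : ℂ)) * u x

/-- The phase pairing normalised so that `VectorFourier.fourierIntegral` against it is the
inverse Fourier integral with kernel `exp (I * x · ξ)`. -/
noncomputable def phasePairing (n : ℕ) : (Fin n → ℝ) →L[ℝ] (Fin n → ℝ) →L[ℝ] ℝ :=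
  (-(2 * Real.pi)⁻¹) • ∑ i : Fin n, (ContinuousLinearMap.proj (R := ℝ) i).smulRight
    (ContinuousLinearMap.proj (R := ℝ) (φ := fun _ : Fin n => ℝ) i)

lemma phasePairing_apply {n : ℕ} (ξ x : Fin n → ℝ) :
    phasePairing n ξ x = -(2 * Real.pi)⁻¹ * ∑ i, x i * ξ i := by
  simp [phasePairing, mul_comm]

/-- The unnormalised inverse Fourier integral `∫ exp (I * x · ξ) w(ξ) dξ`. -/
noncomputable def invFourierIntegral {n : ℕ} (w : (Fin n → ℝ) → ℂ) (x : Fin n → ℝ) : ℂ :=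
  ∫ ξ, Complex.exp (Complex.I * ((∑ i, x i * ξ i : ℝ) : ℂ)) * w ξ

lemma fourierChar_neg_phasePairing {n : ℕ} (ξ x : Fin n → ℝ) :
    (Real.fourierChar (-phasePairing n ξ x) : ℂ) =
      Complex.exp (Complex.I * ((∑ i, x i * ξ i : ℝ) : ℂ)) := by
  rw [Real.fourierChar_apply, phasePairing_apply, mul_comm Complex.I]
  congr 3
  field_simp

lemma invFourierIntegral_eq {n : ℕ} (w : (Fin n → ℝ) → ℂ) :
    invFourierIntegral w = VectorFourier.fourierIntegral Real.fourierChar volume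
      (phasePairing n).toLinearMap₁₂ w := by
  ext x
  simp only [invFourierIntegral, VectorFourier.fourierIntegral]
  refine integral_congr_ae (.of_forall fun ξ => ?_)
  have h := fourierChar_neg_phasePairing ξ x
  simp only [Circle.smul_def, smul_eq_mul]
  rw [← h]
  rfl

/-- Measurable functions all of whose absolute moments are finite. -/
def HasMoments {n : ℕ} (w : (Fin n → ℝ) → ℂ) : Prop :=
  AEStronglyMeasurable w volume ∧ ∀ k : ℕ, Integrable (fun ξ => ‖ξ‖ ^ k * ‖w ξ‖) volume

lemma HasMoments.integrable {n : ℕ} {w : (Fin n → ℝ) → ℂ} (hw : HasMoments w) :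
    Integrable w volume := by
  have h := hw.2 0
  simp only [pow_zero, one_mul] at h
  exact (integrable_norm_iff hw.1).1 h

lemma HasMoments.coord_mul {n : ℕ} {w : (Fin n → ℝ) → ℂ} (hw : HasMoments w) (i : Fin n) :
    HasMoments (fun ξ => (Complex.I * (ξ i : ℂ)) * w ξ) := by
  have hmeas : AEStronglyMeasurable (fun ξ : Fin n → ℝ => (Complex.I * (ξ i : ℂ)) * w ξ) volume :=
    AEStronglyMeasurable.mul (Continuous.aestronglyMeasurable (by fun_prop)) hw.1
  refine ⟨hmeas, fun k => (hw.2 (k + 1)).mono' ?_ (.of_forall fun ξ => ?_)⟩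
  · exact AEStronglyMeasurable.mul (Continuous.aestronglyMeasurable (by fun_prop)) hmeas.norm
  · have h : |ξ i| ≤ ‖ξ‖ := norm_le_pi_norm ξ i
    rw [Real.norm_of_nonneg (by positivity), norm_mul, norm_mul, Complex.norm_I, one_mul,
      Complex.norm_real, Real.norm_eq_abs]
    calc ‖ξ‖ ^ k * (|ξ i| * ‖w ξ‖) ≤ ‖ξ‖ ^ k * (‖ξ‖ * ‖w ξ‖) := by gcongr
      _ = ‖ξ‖ ^ (k + 1) * ‖w ξ‖ := by ring

lemma HasMoments.contDiff {n : ℕ} {w : (Fin n → ℝ) → ℂ} (hw : HasMoments w) :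
    ContDiff ℝ (⊤ : ℕ∞) (invFourierIntegral w) := by
  rw [invFourierIntegral_eq]
  exact VectorFourier.contDiff_fourierIntegral _ fun k _ => hw.2 k

lemma HasMoments.pd_invFourierIntegral {n : ℕ} {w : (Fin n → ℝ) → ℂ} (hw : HasMoments w)
    (i : Fin n) :
    pd i (invFourierIntegral w) =
      invFourierIntegral (fun ξ => (Complex.I * (ξ i : ℂ)) * w ξ) := by
  ext x
  have hmom : Integrable (fun ξ => ‖ξ‖ * ‖w ξ‖) volume := by simpa using hw.2 1
  have hderiv := VectorFourier.hasFDerivAt_fourierIntegral (phasePairing n) hw.integrable hmom x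
  rw [← invFourierIntegral_eq] at hderiv
  have hint : Integrable (VectorFourier.fourierSMulRight (phasePairing n) w) volume := by
    refine (hmom.const_mul (2 * Real.pi * ‖phasePairing n‖)).mono'
      hw.1.fourierSMulRight (.of_forall fun ξ => ?_)
    refine (VectorFourier.norm_fourierSMulRight_le _ _ _).trans (le_of_eq (by ring))
  have hsymbol (ξ : Fin n → ℝ) : VectorFourier.fourierSMulRight (phasePairing n) w ξ
      (Pi.single i 1) = (Complex.I * (ξ i : ℂ)) * w ξ := by
    have hpi : (Real.pi : ℂ) ≠ 0 := by exact_mod_cast Real.pi_ne_zero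
    simp only [VectorFourier.fourierSMulRight_apply, phasePairing_apply, Pi.single_apply, ite_mul,
      one_mul, zero_mul, Finset.sum_ite_eq', Finset.mem_univ, if_true, Complex.real_smul,
      smul_eq_mul]
    push_cast
    field_simp
  rw [pd, hderiv.fderiv, invFourierIntegral_eq]
  simp only [VectorFourier.fourierIntegral]
  rw [ContinuousLinearMap.integral_apply ((VectorFourier.fourierIntegral_convergent_iff
    Real.continuous_fourierChar (by apply (phasePairing n).continuous₂) x).2 hint)]
  refine integral_congr_ae (.of_forall fun ξ => ?_)
  exact congrArg (fun z : ℂ => Real.fourierChar (-phasePairing n ξ x) • z) (hsymbol ξ)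

lemma HasMoments.iterate_pd {n : ℕ} (i : Fin n) (k : ℕ) {w : (Fin n → ℝ) → ℂ}
    (hw : HasMoments w) :
    HasMoments (fun ξ => (Complex.I * (ξ i : ℂ)) ^ k * w ξ) ∧
      (pd i)^[k] (invFourierIntegral w) =
        invFourierIntegral (fun ξ => (Complex.I * (ξ i : ℂ)) ^ k * w ξ) := by
  induction k with
  | zero => simpa using hw
  | succ k ih =>
    have h (ξ : Fin n → ℝ) : (Complex.I * (ξ i : ℂ)) ^ (k + 1) * w ξ =
        (Complex.I * (ξ i : ℂ)) * ((Complex.I * (ξ i : ℂ)) ^ k * w ξ) := by ring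
    simp only [h, Function.iterate_succ_apply', ih.2]
    exact ⟨ih.1.coord_mul i, ih.1.pd_invFourierIntegral i⟩

lemma HasMoments.mderiv_invFourierIntegral {n : ℕ} (α : Fin n → ℕ) {w : (Fin n → ℝ) → ℂ}
    (hw : HasMoments w) :
    mderiv α (invFourierIntegral w) =
      invFourierIntegral (fun ξ => (∏ i, (Complex.I * (ξ i : ℂ)) ^ α i) * w ξ) := by
  have key (l : List (Fin n)) :
      HasMoments (fun ξ => (l.map fun i => (Complex.I * (ξ i : ℂ)) ^ α i).prod * w ξ) ∧
      l.foldr (fun i g => (pd i)^[α i] g) (invFourierIntegral w) = invFourierIntegral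
        (fun ξ => (l.map fun i => (Complex.I * (ξ i : ℂ)) ^ α i).prod * w ξ) := by
    induction l with
    | nil => simpa using hw
    | cons i l ih =>
      simp only [List.map_cons, List.prod_cons, List.foldr_cons, ih.2, mul_assoc]
      exact ih.1.iterate_pd i (α i)
  rw [mderiv, (key _).2]
  simp only [← List.ofFn_eq_map, List.prod_ofFn]

lemma norm_invFourierIntegral_le {n : ℕ} (w : (Fin n → ℝ) → ℂ) (x : Fin n → ℝ) :
    ‖invFourierIntegral w x‖ ≤ ∫ ξ, ‖w ξ‖ := by
  refine (norm_integral_le_integral_norm _).trans (le_of_eq ?_)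
  refine integral_congr_ae (.of_forall fun ξ => ?_)
  simp only [norm_mul, mul_comm Complex.I, Complex.norm_exp_ofReal_mul_I, one_mul]

lemma one_le_jb {n : ℕ} (ξ : Fin n → ℝ) : 1 ≤ jb ξ := by
  rw [jb, Real.one_le_sqrt]
  linarith [Finset.sum_nonneg fun i (_ : i ∈ Finset.univ) => sq_nonneg (ξ i)]

lemma abs_le_jb {n : ℕ} (ξ : Fin n → ℝ) (i : Fin n) : |ξ i| ≤ jb ξ := by
  apply Real.abs_le_sqrt
  linarith [Finset.single_le_sum (fun j _ => sq_nonneg (ξ j)) (Finset.mem_univ i)]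

lemma norm_le_jb {n : ℕ} (ξ : Fin n → ℝ) : ‖ξ‖ ≤ jb ξ :=
  (pi_norm_le_iff_of_nonneg (zero_le_one.trans (one_le_jb ξ))).2 (abs_le_jb ξ)

/-- Gevrey bound: `r ^ k` against a stretched exponential of order `1 / σ`. -/
lemma pow_mul_exp_le {σ δ ε r : ℝ} (hσ : 0 < σ) (hδ : 0 < δ) (hε : 0 < ε) (hr : 0 ≤ r) (k : ℕ) :
    r ^ k * Real.exp (-(δ * ε ^ (1 / σ) * r ^ (1 / σ))) ≤
      ((σ / δ) ^ σ) ^ k * (k.factorial : ℝ) ^ σ * (ε ^ k)⁻¹ := by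
  set s : ℝ := δ / σ * (ε * r) ^ (1 / σ) with hs
  have hs0 : 0 ≤ s := by positivity
  have hexp : Real.exp (-(δ * ε ^ (1 / σ) * r ^ (1 / σ))) = (Real.exp (-s)) ^ σ := by
    rw [← Real.exp_mul, hs, Real.mul_rpow hε.le hr]
    congr 1
    field_simp
  have hr' : r = (σ / δ) ^ σ * s ^ σ * ε⁻¹ := by
    rw [hs, ← Real.mul_rpow (by positivity) (by positivity), ← mul_assoc,
      div_mul_div_cancel₀ hδ.ne', div_self hσ.ne', one_mul, ← Real.rpow_mul (by positivity),
      one_div_mul_cancel hσ.ne', Real.rpow_one]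
    field_simp
  have hfac : (s ^ k * Real.exp (-s)) ^ σ ≤ (k.factorial : ℝ) ^ σ := by
    refine Real.rpow_le_rpow (by positivity) ?_ hσ.le
    have h := Real.pow_div_factorial_le_exp s hs0 k
    rw [div_le_iff₀ (by positivity)] at h
    rw [Real.exp_neg, ← div_eq_mul_inv, div_le_iff₀ (Real.exp_pos s)]
    linarith
  rw [hexp]
  calc r ^ k * Real.exp (-s) ^ σ
      = ((σ / δ) ^ σ) ^ k * (s ^ k * Real.exp (-s)) ^ σ * (ε ^ k)⁻¹ := by
        rw [Real.mul_rpow (by positivity) (by positivity), ← Real.rpow_pow_comm hs0]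
        conv_lhs => rw [hr']
        rw [mul_pow, mul_pow, inv_pow]
        ring
    _ ≤ _ := by gcongr

lemma inv_jb_pow_le {n : ℕ} (ξ : Fin n → ℝ) (m : ℕ) :
    (jb ξ ^ m)⁻¹ ≤ 2 ^ m * ((1 + ‖ξ‖) ^ m)⁻¹ := by
  have h1 := one_le_jb ξ
  have h2 := norm_le_jb ξ
  have hpos : 0 < jb ξ := by linarith
  rw [← div_eq_mul_inv, ← div_pow, ← inv_pow]
  refine pow_le_pow_left₀ (by positivity) ?_ m
  rw [inv_le_comm₀ hpos (by positivity), inv_div, div_le_iff₀ two_pos]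
  linarith

lemma integrable_inv_one_add_norm_pow (n : ℕ) :
    Integrable (fun ξ : Fin n → ℝ => ((1 + ‖ξ‖) ^ (n + 1))⁻¹) volume := by
  have h := integrable_one_add_norm (E := Fin n → ℝ) (μ := volume) (r := ((n + 1 : ℕ) : ℝ))
    (by simp)
  refine h.congr (.of_forall fun ξ => ?_)
  simp only
  rw [Real.rpow_neg (by positivity), Real.rpow_natCast]

lemma jb_pow_mul_exp_le {n : ℕ} {σ δ ε : ℝ} (hσ : 0 < σ) (hδ : 0 < δ) (hε : 0 < ε)
    (ξ : Fin n → ℝ) (k m : ℕ) :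
    jb ξ ^ k * Real.exp (-(δ * ε ^ (1 / σ) * jb ξ ^ (1 / σ))) ≤
      ((σ / δ) ^ σ) ^ (k + m) * ((k + m).factorial : ℝ) ^ σ * (ε ^ (k + m))⁻¹ *
        (2 ^ m * ((1 + ‖ξ‖) ^ m)⁻¹) := by
  have hpos : 0 < jb ξ := zero_lt_one.trans_le (one_le_jb ξ)
  calc jb ξ ^ k * Real.exp (-(δ * ε ^ (1 / σ) * jb ξ ^ (1 / σ)))
      = jb ξ ^ (k + m) * Real.exp (-(δ * ε ^ (1 / σ) * jb ξ ^ (1 / σ))) * (jb ξ ^ m)⁻¹ := by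
        rw [pow_add]
        field_simp
    _ ≤ _ := by
        exact mul_le_mul (pow_mul_exp_le hσ hδ hε hpos.le (k + m)) (inv_jb_pow_le ξ m)
          (by positivity) (by positivity)

lemma hasMoments_of_norm_le {n : ℕ} {σ c ε A : ℝ} (hσ : 0 < σ) (hc : 0 < c) (hε : 0 < ε)
    (hA : 0 ≤ A) {w : (Fin n → ℝ) → ℂ} (hw : AEStronglyMeasurable w volume)
    (hbd : ∀ ξ, ‖w ξ‖ ≤ A * Real.exp (-(c * ε ^ (1 / σ) * jb ξ ^ (1 / σ)))) :
    HasMoments w := by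
  refine ⟨hw, fun k => ((integrable_inv_one_add_norm_pow n).const_mul
    (A * (((σ / c) ^ σ) ^ (k + (n + 1)) * ((k + (n + 1)).factorial : ℝ) ^ σ *
      (ε ^ (k + (n + 1)))⁻¹ * 2 ^ (n + 1)))).mono' ?_ (.of_forall fun ξ => ?_)⟩
  · exact AEStronglyMeasurable.mul (Continuous.aestronglyMeasurable (by fun_prop)) hw.norm
  · rw [Real.norm_of_nonneg (by positivity)]
    calc ‖ξ‖ ^ k * ‖w ξ‖
        ≤ jb ξ ^ k * (A * Real.exp (-(c * ε ^ (1 / σ) * jb ξ ^ (1 / σ)))) :=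
          mul_le_mul (pow_le_pow_left₀ (norm_nonneg ξ) (norm_le_jb ξ) k) (hbd ξ) (norm_nonneg _)
            (pow_nonneg (zero_le_one.trans (one_le_jb ξ)) k)
      _ = A * (jb ξ ^ k * Real.exp (-(c * ε ^ (1 / σ) * jb ξ ^ (1 / σ)))) := by ring
      _ ≤ A * _ := mul_le_mul_of_nonneg_left (jb_pow_mul_exp_le hσ hc hε ξ k (n + 1)) hA
      _ = _ := by ring

lemma prod_pow_mul_exp_le {n : ℕ} {σ δ ε : ℝ} (hσ : 0 < σ) (hδ : 0 < δ) (hε : 0 < ε)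
    (α : Fin n → ℕ) (ξ : Fin n → ℝ) :
    (∏ i, |ξ i| ^ α i) * Real.exp (-((n + 1) * δ * ε ^ (1 / σ) * jb ξ ^ (1 / σ))) ≤
      ((σ / δ) ^ σ) ^ mdeg α * (mfact α : ℝ) ^ σ * (ε ^ mdeg α)⁻¹ := by
  have hpos : 0 < jb ξ := zero_lt_one.trans_le (one_le_jb ξ)
  have hsum : ∑ i, |ξ i| ^ (1 / σ) ≤ (n + 1) * jb ξ ^ (1 / σ) := by
    calc ∑ i, |ξ i| ^ (1 / σ) ≤ ∑ _i : Fin n, jb ξ ^ (1 / σ) :=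
          Finset.sum_le_sum fun i _ =>
            Real.rpow_le_rpow (abs_nonneg _) (abs_le_jb ξ i) (by positivity)
      _ = n * jb ξ ^ (1 / σ) := by simp
      _ ≤ (n + 1) * jb ξ ^ (1 / σ) := by gcongr; linarith
  have hexp : Real.exp (-((n + 1) * δ * ε ^ (1 / σ) * jb ξ ^ (1 / σ))) ≤
      ∏ i, Real.exp (-(δ * ε ^ (1 / σ) * |ξ i| ^ (1 / σ))) := by
    rw [← Real.exp_sum, Finset.sum_neg_distrib, ← Finset.mul_sum]
    refine Real.exp_le_exp.2 (neg_le_neg ?_)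
    calc δ * ε ^ (1 / σ) * ∑ i, |ξ i| ^ (1 / σ)
        ≤ δ * ε ^ (1 / σ) * ((n + 1) * jb ξ ^ (1 / σ)) := by gcongr
      _ = _ := by ring
  calc (∏ i, |ξ i| ^ α i) * Real.exp (-((n + 1) * δ * ε ^ (1 / σ) * jb ξ ^ (1 / σ)))
      ≤ (∏ i, |ξ i| ^ α i) * ∏ i, Real.exp (-(δ * ε ^ (1 / σ) * |ξ i| ^ (1 / σ))) := by
        gcongr
    _ = ∏ i, |ξ i| ^ α i * Real.exp (-(δ * ε ^ (1 / σ) * |ξ i| ^ (1 / σ))) :=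
        Finset.prod_mul_distrib.symm
    _ ≤ ∏ i, ((σ / δ) ^ σ) ^ α i * ((α i).factorial : ℝ) ^ σ * (ε ^ α i)⁻¹ :=
        Finset.prod_le_prod (fun i _ => by positivity) fun i _ =>
          pow_mul_exp_le hσ hδ hε (abs_nonneg _) (α i)
    _ = _ := by
        rw [Finset.prod_mul_distrib, Finset.prod_mul_distrib, Finset.prod_pow_eq_pow_sum,
          Real.finsetProd_rpow _ _ (fun i _ => by positivity), Finset.prod_inv_distrib,
          Finset.prod_pow_eq_pow_sum]
        simp [mdeg, mfact]

/-- Gevrey bounds for the derivatives of the inverse Fourier integral of a function dominated by a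
stretched exponential, with the constants explicit. -/
lemma norm_mderiv_invFourierIntegral_le {n : ℕ} {σ δ ε A : ℝ} (hσ : 0 < σ) (hδ : 0 < δ)
    (hε : 0 < ε) (hA : 0 ≤ A) {w : (Fin n → ℝ) → ℂ} (hw : HasMoments w)
    (hbd : ∀ ξ, ‖w ξ‖ ≤ A * Real.exp (-((n + 2) * δ * ε ^ (1 / σ) * jb ξ ^ (1 / σ))))
    (α : Fin n → ℕ) (x : Fin n → ℝ) :
    ‖mderiv α (invFourierIntegral w) x‖ ≤
      A * (((σ / δ) ^ σ) ^ mdeg α * (mfact α : ℝ) ^ σ * (ε ^ mdeg α)⁻¹) *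
        (((σ / δ) ^ σ) ^ (n + 1) * ((n + 1).factorial : ℝ) ^ σ * (ε ^ (n + 1))⁻¹ * 2 ^ (n + 1)) *
        ∫ ξ : Fin n → ℝ, ((1 + ‖ξ‖) ^ (n + 1))⁻¹ := by
  rw [hw.mderiv_invFourierIntegral, ← integral_const_mul]
  refine (norm_invFourierIntegral_le _ x).trans (integral_mono_of_nonneg
    (.of_forall fun ξ => norm_nonneg _) ((integrable_inv_one_add_norm_pow n).const_mul _)
    (.of_forall fun ξ => ?_))
  have hprod : ‖∏ i, (Complex.I * (ξ i : ℂ)) ^ α i‖ = ∏ i, |ξ i| ^ α i := by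
    simp [norm_prod]
  have hsplit : Real.exp (-((n + 2) * δ * ε ^ (1 / σ) * jb ξ ^ (1 / σ))) =
      Real.exp (-((n + 1) * δ * ε ^ (1 / σ) * jb ξ ^ (1 / σ))) *
        Real.exp (-(δ * ε ^ (1 / σ) * jb ξ ^ (1 / σ))) := by
    rw [← Real.exp_add]
    congr 1
    ring
  have hdecay := jb_pow_mul_exp_le hσ hδ hε ξ 0 (n + 1)
  rw [pow_zero, one_mul, zero_add] at hdecay
  simp only [norm_mul, hprod]
  calc (∏ i, |ξ i| ^ α i) * ‖w ξ‖
      ≤ (∏ i, |ξ i| ^ α i) * (A * Real.exp (-((n + 2) * δ * ε ^ (1 / σ) * jb ξ ^ (1 / σ)))) := by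
        gcongr
        exact hbd ξ
    _ = A * (((∏ i, |ξ i| ^ α i) *
          Real.exp (-((n + 1) * δ * ε ^ (1 / σ) * jb ξ ^ (1 / σ)))) *
        Real.exp (-(δ * ε ^ (1 / σ) * jb ξ ^ (1 / σ)))) := by
        rw [hsplit]
        ring
    _ ≤ A * ((((σ / δ) ^ σ) ^ mdeg α * (mfact α : ℝ) ^ σ * (ε ^ mdeg α)⁻¹) * _) := by
        refine mul_le_mul_of_nonneg_left ?_ hA
        exact mul_le_mul (prod_pow_mul_exp_le hσ hδ hε α ξ) hdecay (by positivity) (by positivity)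
    _ = _ := by ring

theorem stmt_3 (n : ℕ) (σ : ℝ) (hσ : 1 < σ)
    (v : ℝ → (Fin n → ℝ) → ℂ)
    (hmeas : ∀ ε ∈ Set.Ioc (0:ℝ) 1, AEStronglyMeasurable (v ε) volume)
    (c c' : ℝ) (hc : 0 < c) (hc' : 0 < c') (N : ℕ)
    (hbd : ∀ ε ∈ Set.Ioc (0:ℝ) 1, ∀ ξ : Fin n → ℝ,
      ‖v ε ξ‖ ≤ c' * (ε ^ N)⁻¹ * Real.exp (-c * ε ^ (1/σ) * jb ξ ^ (1/σ)))
    (u : ℝ → (Fin n → ℝ) → ℂ)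
    (hu : ∀ ε ∈ Set.Ioc (0:ℝ) 1, ∀ x : Fin n → ℝ, u ε x =
      ((2 * Real.pi) ^ n)⁻¹ • ∫ ξ, Complex.exp (Complex.I * ((∑ i, x i * ξ i : ℝ) : ℂ)) * v ε ξ) :
    (∀ ε ∈ Set.Ioc (0:ℝ) 1, ContDiff ℝ (⊤ : ℕ∞) (u ε)) ∧
    ∃ C : ℝ, 0 < C ∧ ∃ M : ℕ, ∀ ε ∈ Set.Ioc (0:ℝ) 1, ∀ (α : Fin n → ℕ) (x : Fin n → ℝ),
      ‖mderiv α (u ε) x‖ ≤ C ^ (mdeg α + 1) * (mfact α : ℝ) ^ σ * (ε ^ (mdeg α + M))⁻¹ := by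
  have hσ0 : 0 < σ := zero_lt_one.trans hσ
  obtain ⟨δ, hδ, hcδ⟩ : ∃ δ : ℝ, 0 < δ ∧ c = (n + 2) * δ :=
    ⟨c / (n + 2), by positivity, by field_simp⟩
  set K : ℝ := ((2 * Real.pi) ^ n)⁻¹ with hK
  have hK0 : 0 < K := by positivity
  have hu' (ε : ℝ) (hε : ε ∈ Set.Ioc (0 : ℝ) 1) :
      u ε = invFourierIntegral (fun ξ => K • v ε ξ) := by
    ext x
    rw [hu ε hε x, invFourierIntegral, ← integral_smul]
    simp only [mul_smul_comm]
  have hbd' (ε : ℝ) (hε : ε ∈ Set.Ioc (0 : ℝ) 1) (ξ : Fin n → ℝ) :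
      ‖K • v ε ξ‖ ≤ K * c' * (ε ^ N)⁻¹ *
        Real.exp (-((n + 2) * δ * ε ^ (1 / σ) * jb ξ ^ (1 / σ))) := by
    rw [norm_smul, Real.norm_of_nonneg hK0.le, mul_assoc K, mul_assoc K]
    refine mul_le_mul_of_nonneg_left ((hbd ε hε ξ).trans (le_of_eq ?_)) hK0.le
    rw [hcδ]
    congr 2
    ring
  have hmom (ε : ℝ) (hε : ε ∈ Set.Ioc (0 : ℝ) 1) : HasMoments (fun ξ => K • v ε ξ) := by
    have hε0 := hε.1
    exact hasMoments_of_norm_le hσ0 (by positivity) hε0 (by positivity)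
      ((hmeas ε hε).const_smul K) (hbd' ε hε)
  refine ⟨fun ε hε => hu' ε hε ▸ (hmom ε hε).contDiff, ?_⟩
  set B : ℝ := (σ / δ) ^ σ
  have hB : 0 < B := by positivity
  set J : ℝ := ∫ ξ : Fin n → ℝ, ((1 + ‖ξ‖) ^ (n + 1))⁻¹
  have hJ : 0 ≤ J := integral_nonneg fun ξ => by positivity
  set D : ℝ := K * c' * (B ^ (n + 1) * ((n + 1).factorial : ℝ) ^ σ * 2 ^ (n + 1)) * J
  have hD : 0 ≤ D := by positivity
  refine ⟨D + B, by positivity, N + (n + 1), fun ε hε α x => ?_⟩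
  have hε0 := hε.1
  rw [hu' ε hε]
  refine (norm_mderiv_invFourierIntegral_le hσ0 hδ hε0 (by positivity) (hmom ε hε)
    (hbd' ε hε) α x).trans ?_
  calc _ = B ^ mdeg α * D * (mfact α : ℝ) ^ σ * (ε ^ (mdeg α + (N + (n + 1))))⁻¹ := by
        rw [pow_add ε, pow_add ε, mul_inv, mul_inv]
        ring
    _ ≤ _ := by
        rw [pow_succ]
        gcongr <;> linarith
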